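/- For nonzero vectors w, w' in ℝᵏ and a standard Gaussian random vector v in ℝᵏ, the probability that sgn(⟨v,w⟩) ≠ sgn(⟨v,w'⟩) equals (1/π)·arccos(⟨w,w'⟩/(‖w‖·‖w'‖)). -/

import Mathlib

open MeasureTheory ProbabilityTheory RealInnerProductSpace

/-! ### The sign function -/

theorem Real.sign_mul_of_pos {a : ℝ} (ha : 0 < a) (x : ℝ) : Real.sign (a * x) = Real.sign x := by
  rcases lt_trichotomy x 0 with hx | rfl | hx
  · rw [Real.sign_of_neg hx, Real.sign_of_neg (mul_neg_of_pos_of_neg ha hx)]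
  · simp
  · rw [Real.sign_of_pos hx, Real.sign_of_pos (mul_pos ha hx)]

theorem Real.measurable_sign : Measurable Real.sign :=
  Measurable.ite measurableSet_Iio measurable_const
    (Measurable.ite measurableSet_Ioi measurable_const measurable_const)

theorem measurableSet_sign_ne {α : Type*} [MeasurableSpace α] {f g : α → ℝ}
    (hf : Measurable f) (hg : Measurable g) :
    MeasurableSet {a | Real.sign (f a) ≠ Real.sign (g a)} :=
  (measurableSet_eq_fun (Real.measurable_sign.comp hf) (Real.measurable_sign.comp hg)).compl

/-! ### Pairs of linear functionals of a standard Gaussian vector -/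

theorem norm_dual_comp_inner_prod {E : Type*} [NormedAddCommGroup E]
    [InnerProductSpace ℝ E] (u u' : E) (L : StrongDual ℝ (ℝ × ℝ)) :
    ‖L.comp ((innerSL ℝ u).prod (innerSL ℝ u'))‖ = ‖L (1, 0) • u + L (0, 1) • u'‖ := by
  rw [← innerSL_apply_norm (𝕜 := ℝ) (L (1, 0) • u + L (0, 1) • u')]
  congr 1
  ext v
  have hv : ((⟪u, v⟫, ⟪u', v⟫) : ℝ × ℝ) = ⟪u, v⟫ • (1, 0) + ⟪u', v⟫ • (0, 1) := by simp
  simp only [ContinuousLinearMap.comp_apply, ContinuousLinearMap.prod_apply, innerSL_apply_apply,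
    inner_add_left, real_inner_smul_left]
  rw [hv, map_add, map_smul, map_smul, smul_eq_mul, smul_eq_mul]
  ring

section Gram

variable {E F : Type*}
  [NormedAddCommGroup E] [InnerProductSpace ℝ E] [FiniteDimensional ℝ E] [MeasurableSpace E]
  [BorelSpace E]
  [NormedAddCommGroup F] [InnerProductSpace ℝ F] [FiniteDimensional ℝ F] [MeasurableSpace F]
  [BorelSpace F]

/-- The joint law of two linear functionals of a standard Gaussian vector depends only on their
Gram matrix. -/
theorem stdGaussian_map_inner_prod_congr {u u' : E} {x x' : F}
    (h : ‖u‖ = ‖x‖) (h' : ‖u'‖ = ‖x'‖) (hi : ⟪u, u'⟫ = ⟪x, x'⟫) :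
    (stdGaussian E).map ((innerSL ℝ u).prod (innerSL ℝ u')) =
      (stdGaussian F).map ((innerSL ℝ x).prod (innerSL ℝ x')) := by
  apply Measure.ext_of_charFunDual
  ext L
  rw [charFunDual_map, charFunDual_map, charFunDual_stdGaussian, charFunDual_stdGaussian]
  simp only [norm_dual_comp_inner_prod, ← Complex.ofReal_pow, norm_add_sq_real, norm_smul,
    real_inner_smul_left, real_inner_smul_right, h, h', hi]

end Gram

theorem pi_gaussianReal_sign_ne_eq_map {ι : Type*} [Fintype ι] (w w' : EuclideanSpace ℝ ι) :
    (Measure.pi fun _ : ι => gaussianReal 0 1)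
        {v | Real.sign (∑ i, v i * w i) ≠ Real.sign (∑ i, v i * w' i)} =
      ((stdGaussian (EuclideanSpace ℝ ι)).map ((innerSL ℝ w).prod (innerSL ℝ w')))
        {p | Real.sign p.1 ≠ Real.sign p.2} := by
  have hs : MeasurableSet {p : ℝ × ℝ | Real.sign p.1 ≠ Real.sign p.2} :=
    measurableSet_sign_ne measurable_fst measurable_snd
  rw [← map_pi_eq_stdGaussian, Measure.map_map (by fun_prop) (by fun_prop),
    Measure.map_apply (by fun_prop) hs]
  congr 1

/-! ### Cones in the plane -/

/-- The radial part of the planar standard Gaussian density in polar coordinates. -/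
noncomputable def gaussianRadialDensity (r : ℝ) : ENNReal :=
  ENNReal.ofReal r * ENNReal.ofReal ((2 * Real.pi)⁻¹ * Real.exp (-r ^ 2 / 2))

theorem gaussianPDF_mul_gaussianPDF_polarCoord_symm (p : ℝ × ℝ) :
    gaussianPDF 0 1 (polarCoord.symm p).1 * gaussianPDF 0 1 (polarCoord.symm p).2 =
      ENNReal.ofReal ((2 * Real.pi)⁻¹ * Real.exp (-p.1 ^ 2 / 2)) := by
  rw [gaussianPDF, gaussianPDF, ← ENNReal.ofReal_mul (gaussianPDFReal_nonneg _ _ _)]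
  congr 1
  simp only [gaussianPDFReal, polarCoord_symm_apply, NNReal.coe_one, mul_one, sub_zero]
  rw [mul_mul_mul_comm, ← Real.exp_add, ← mul_inv, Real.mul_self_sqrt (by positivity)]
  congr 2
  linear_combination (-p.1 ^ 2 / 2) * Real.sin_sq_add_cos_sq p.2

theorem gaussianReal_prod_cone {C : Set (ℝ × ℝ)} (hC : MeasurableSet C) {A : Set ℝ}
    (hA : MeasurableSet A)
    (h : ∀ r φ : ℝ, 0 < r → ((r * Real.cos φ, r * Real.sin φ) ∈ C ↔ φ ∈ A)) :
    ((gaussianReal 0 1).prod (gaussianReal 0 1)) C =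
      (∫⁻ r in Set.Ioi 0, gaussianRadialDensity r) *
        volume (A ∩ Set.Ioo (-Real.pi) Real.pi) := by
  have hm : Measurable fun z : ℝ × ℝ => gaussianPDF 0 1 z.1 * gaussianPDF 0 1 z.2 := by
    have := measurable_gaussianPDF 0 1
    fun_prop
  rw [gaussianReal_of_var_ne_zero 0 one_ne_zero,
    prod_withDensity (measurable_gaussianPDF 0 1) (measurable_gaussianPDF 0 1),
    withDensity_apply _ hC, ← lintegral_indicator hC, ← Measure.volume_eq_prod,
    ← lintegral_comp_polarCoord_symm]
  have hcongr : ∀ p ∈ polarCoord.target,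
      ENNReal.ofReal p.1 • C.indicator (fun z : ℝ × ℝ => gaussianPDF 0 1 z.1 * gaussianPDF 0 1 z.2)
        (polarCoord.symm p) = gaussianRadialDensity p.1 * A.indicator 1 p.2 := by
    rintro p ⟨hr, -⟩
    have hp : polarCoord.symm p ∈ C ↔ p.2 ∈ A := h p.1 p.2 hr
    by_cases hpA : p.2 ∈ A
    · rw [Set.indicator_of_mem (hp.2 hpA), gaussianPDF_mul_gaussianPDF_polarCoord_symm,
        Set.indicator_of_mem hpA, Pi.one_apply, mul_one, smul_eq_mul, gaussianRadialDensity]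
    · rw [Set.indicator_of_notMem (mt hp.1 hpA), Set.indicator_of_notMem hpA, smul_zero, mul_zero]
  rw [setLIntegral_congr_fun polarCoord.open_target.measurableSet hcongr, polarCoord_target,
    Measure.volume_eq_prod, ← Measure.prod_restrict, lintegral_prod_mul,
    lintegral_indicator_one hA, Measure.restrict_apply hA]
  · unfold gaussianRadialDensity
    fun_prop
  · exact (measurable_one.indicator hA).aemeasurable

/-- The planar standard Gaussian measure of a cone is its angle divided by `2 * π`. -/
theorem gaussianReal_prod_cone_eq_div {C : Set (ℝ × ℝ)} (hC : MeasurableSet C) {A : Set ℝ}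
    (hA : MeasurableSet A)
    (h : ∀ r φ : ℝ, 0 < r → ((r * Real.cos φ, r * Real.sin φ) ∈ C ↔ φ ∈ A)) :
    ((gaussianReal 0 1).prod (gaussianReal 0 1)) C =
      volume (A ∩ Set.Ioo (-Real.pi) Real.pi) / ENNReal.ofReal (2 * Real.pi) := by
  have huniv := gaussianReal_prod_cone MeasurableSet.univ MeasurableSet.univ (by simp)
  rw [measure_univ, Set.univ_inter, Real.volume_Ioo,
    show Real.pi - -Real.pi = 2 * Real.pi by ring] at huniv
  rw [gaussianReal_prod_cone hC hA h, ENNReal.eq_inv_of_mul_eq_one_left huniv.symm, mul_comm,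
    div_eq_mul_inv]

/-! ### The angular sector where two half-planes disagree -/

theorem volume_sign_cos_ne {h : ℝ} (h0 : 0 ≤ h) (hpi : h ≤ Real.pi / 2) :
    volume ({φ | Real.sign (Real.cos (φ - h)) ≠ Real.sign (Real.cos (φ + h))} ∩
      Set.Ioo (-Real.pi) Real.pi) = ENNReal.ofReal (4 * h) := by
  have hadd : ENNReal.ofReal (4 * h) = ENNReal.ofReal (2 * h) + ENNReal.ofReal (2 * h) := by
    rw [← ENNReal.ofReal_add (by positivity) (by positivity)]
    congr 1
    ring
  have cos_neg' : ∀ {x : ℝ}, -(3 * Real.pi / 2) < x → x < -(Real.pi / 2) → Real.cos x < 0 := by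
    intro x h₁ h₂
    rw [← Real.cos_neg]
    exact Real.cos_neg_of_pi_div_two_lt_of_lt (by linarith) (by linarith)
  apply le_antisymm
  · calc _ ≤ volume (Set.Icc (Real.pi / 2 - h) (Real.pi / 2 + h) ∪
          Set.Icc (-(Real.pi / 2) - h) (-(Real.pi / 2) + h)) := by
          refine measure_mono ?_
          rintro φ ⟨hne, h₁, h₂⟩
          by_contra hφ
          simp only [Set.mem_union, Set.mem_Icc, not_or, not_and_or, not_le] at hφ
          apply hne
          obtain ⟨ha | ha, hb | hb⟩ := hφ
          · rw [Real.sign_of_neg (cos_neg' (by linarith) (by linarith)),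
              Real.sign_of_neg (cos_neg' (by linarith) (by linarith))]
          · rw [Real.sign_of_pos (Real.cos_pos_of_mem_Ioo ⟨by linarith, by linarith⟩),
              Real.sign_of_pos (Real.cos_pos_of_mem_Ioo ⟨by linarith, by linarith⟩)]
          · linarith
          · rw [Real.sign_of_neg
                (Real.cos_neg_of_pi_div_two_lt_of_lt (by linarith) (by linarith)),
              Real.sign_of_neg
                (Real.cos_neg_of_pi_div_two_lt_of_lt (by linarith) (by linarith))]
      _ ≤ _ := measure_union_le _ _
      _ = _ := by
          rw [Real.volume_Icc, Real.volume_Icc, hadd]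
          congr 2 <;> ring
  · calc ENNReal.ofReal (4 * h)
        = volume (Set.Ioo (Real.pi / 2 - h) (Real.pi / 2 + h) ∪
          Set.Ioo (-(Real.pi / 2) - h) (-(Real.pi / 2) + h)) := by
          rw [measure_union _ measurableSet_Ioo, Real.volume_Ioo, Real.volume_Ioo, hadd]
          · congr 2 <;> ring
          · rw [Set.disjoint_left]
            rintro φ ⟨h₁, h₂⟩ ⟨h₃, h₄⟩
            linarith
      _ ≤ _ := by
          refine measure_mono ?_
          rintro φ (⟨h₁, h₂⟩ | ⟨h₁, h₂⟩)
          · refine ⟨?_, by linarith, by linarith⟩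
            rw [Set.mem_ofPred_eq,
              Real.sign_of_pos (Real.cos_pos_of_mem_Ioo ⟨by linarith, by linarith⟩),
              Real.sign_of_neg (Real.cos_neg_of_pi_div_two_lt_of_lt (by linarith) (by linarith))]
            norm_num
          · refine ⟨?_, by linarith, by linarith⟩
            rw [Set.mem_ofPred_eq, Real.sign_of_neg (cos_neg' (by linarith) (by linarith)),
              Real.sign_of_pos (Real.cos_pos_of_mem_Ioo ⟨by linarith, by linarith⟩)]
            norm_num

/-- Two lines through the origin whose normals have polar angles `h` and `-h`. -/
theorem pi_gaussianReal_fin_two_sign_ne {a b h : ℝ} (ha : 0 < a) (hb : 0 < b) (h0 : 0 ≤ h)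
    (hpi : h ≤ Real.pi / 2) :
    (Measure.pi fun _ : Fin 2 => gaussianReal 0 1)
        {v | Real.sign (∑ i, v i * !₂[a * Real.cos h, a * Real.sin h] i) ≠
          Real.sign (∑ i, v i * !₂[b * Real.cos h, -(b * Real.sin h)] i)} =
      ENNReal.ofReal (1 / Real.pi * (2 * h)) := by
  let C : Set (ℝ × ℝ) :=
    {p | Real.sign (p.1 * (a * Real.cos h) + p.2 * (a * Real.sin h)) ≠
      Real.sign (p.1 * (b * Real.cos h) + p.2 * -(b * Real.sin h))}
  have hC : MeasurableSet C := measurableSet_sign_ne (by fun_prop) (by fun_prop)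
  have hpre := (measurePreserving_piFinTwo fun _ : Fin 2 => gaussianReal 0 1).measure_preimage
    hC.nullMeasurableSet
  have hset : {v : Fin 2 → ℝ | Real.sign (∑ i, v i * !₂[a * Real.cos h, a * Real.sin h] i) ≠
      Real.sign (∑ i, v i * !₂[b * Real.cos h, -(b * Real.sin h)] i)} =
      MeasurableEquiv.piFinTwo (fun _ => ℝ) ⁻¹' C := by
    ext v
    simp [C, Fin.sum_univ_two]
  have hcone : ∀ r φ : ℝ, 0 < r → ((r * Real.cos φ, r * Real.sin φ) ∈ C ↔
      φ ∈ {φ | Real.sign (Real.cos (φ - h)) ≠ Real.sign (Real.cos (φ + h))}) := by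
    intro r φ hr
    have h₁ : r * Real.cos φ * (a * Real.cos h) + r * Real.sin φ * (a * Real.sin h) =
        r * a * Real.cos (φ - h) := by
      rw [Real.cos_sub]
      ring
    have h₂ : r * Real.cos φ * (b * Real.cos h) + r * Real.sin φ * -(b * Real.sin h) =
        r * b * Real.cos (φ + h) := by
      rw [Real.cos_add]
      ring
    simp only [C, Set.mem_ofPred_eq, h₁, h₂, Real.sign_mul_of_pos (mul_pos hr ha),
      Real.sign_mul_of_pos (mul_pos hr hb)]
  rw [hset, hpre, gaussianReal_prod_cone_eq_div hC
      (measurableSet_sign_ne (by fun_prop) (by fun_prop)) hcone,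
    volume_sign_cos_ne h0 hpi, ← ENNReal.ofReal_div_of_pos (by positivity)]
  congr 1
  field_simp
  ring

theorem stmt_5 (k : ℕ) (w w' : EuclideanSpace ℝ (Fin k)) (hw : w ≠ 0) (hw' : w' ≠ 0) :
    (Measure.pi fun _ : Fin k => gaussianReal 0 1)
      {v | Real.sign (∑ i, v i * w i) ≠ Real.sign (∑ i, v i * w' i)} =
    ENNReal.ofReal ((1 / Real.pi) * Real.arccos (⟪w, w'⟫ / (‖w‖ * ‖w'‖))) := by
  change _ = ENNReal.ofReal ((1 / Real.pi) * InnerProductGeometry.angle w w')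
  obtain ⟨h, hh⟩ : ∃ h, InnerProductGeometry.angle w w' = 2 * h :=
    ⟨InnerProductGeometry.angle w w' / 2, by ring⟩
  have h0 : 0 ≤ h := by linarith [InnerProductGeometry.angle_nonneg w w']
  have hpi : h ≤ Real.pi / 2 := by linarith [InnerProductGeometry.angle_le_pi w w']
  have hinner := InnerProductGeometry.cos_angle_mul_norm_mul_norm w w'
  rw [hh, Real.cos_two_mul'] at hinner
  have hsc := Real.sin_sq_add_cos_sq h
  rw [hh, ← pi_gaussianReal_fin_two_sign_ne (norm_pos_iff.2 hw) (norm_pos_iff.2 hw') h0 hpi,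
    pi_gaussianReal_sign_ne_eq_map, pi_gaussianReal_sign_ne_eq_map]
  refine DFunLike.congr_fun (stdGaussian_map_inner_prod_congr ?_ ?_ ?_) _
  · rw [← sq_eq_sq₀ (norm_nonneg _) (norm_nonneg _), EuclideanSpace.real_norm_sq_eq !₂[_, _]]
    simp [Fin.sum_univ_two]
    linear_combination -‖w‖ ^ 2 * hsc
  · rw [← sq_eq_sq₀ (norm_nonneg _) (norm_nonneg _), EuclideanSpace.real_norm_sq_eq !₂[_, _]]
    simp [Fin.sum_univ_two]
    linear_combination -‖w'‖ ^ 2 * hsc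
  · rw [← hinner]
    simp [PiLp.inner_apply, Fin.sum_univ_two]
    ring
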